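/- Let 0 ≤ α < β ≤ ∞ and let f, g be positive continuous functions on the interval (α,β) with ∫_α^β f(x) dx = ∫_α^β g(x) dx = 1, such that x ↦ f(x)/g(x) is non-decreasing on (α,β). Then: (i) the function z ↦ (∫_α^β e^{−zx} f(x) dx) / (∫_α^β e^{−zx} g(x) dx) is non-increasing on (0,∞); and (ii) for every μ > 0, the function z ↦ (∫_α^β (1+xz)^{−μ} f(x) dx) / (∫_α^β (1+xz)^{−μ} g(x) dx) is non-increasing on (0,∞). -/

import Mathlib

open MeasureTheory Set

/-- Symmetrization: a pointwise inequality between the symmetrized products integrates to an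
inequality between products of integrals. -/
theorem setIntegral_mul_setIntegral_le_of_symm {X : Type*} [MeasurableSpace X] {ν : Measure X}
    [SFinite ν] {S : Set X} (hS : MeasurableSet S) {p q r s : X → ℝ}
    (hp : IntegrableOn p S ν) (hq : IntegrableOn q S ν)
    (hr : IntegrableOn r S ν) (hs : IntegrableOn s S ν)
    (h : ∀ x ∈ S, ∀ y ∈ S, r x * s y + s x * r y ≤ p x * q y + q x * p y) :
    (∫ x in S, r x ∂ν) * (∫ x in S, s x ∂ν) ≤ (∫ x in S, p x ∂ν) * (∫ x in S, q x ∂ν) := by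
  have key : ∫ w, (r w.1 * s w.2 + s w.1 * r w.2) ∂((ν.restrict S).prod (ν.restrict S)) ≤
      ∫ w, (p w.1 * q w.2 + q w.1 * p w.2) ∂((ν.restrict S).prod (ν.restrict S)) := by
    refine integral_mono_ae ((hr.mul_prod hs).add (hs.mul_prod hr))
      ((hp.mul_prod hq).add (hq.mul_prod hp)) ?_
    rw [Measure.prod_restrict]
    filter_upwards [ae_restrict_mem (hS.prod hS)] with w hw
    exact h w.1 hw.1 w.2 hw.2
  rw [integral_add (hr.mul_prod hs) (hs.mul_prod hr),
    integral_add (hp.mul_prod hq) (hq.mul_prod hp)] at key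
  simp only [integral_prod_mul] at key
  linarith [mul_comm (∫ x in S, r x ∂ν) (∫ x in S, s x ∂ν),
    mul_comm (∫ x in S, p x ∂ν) (∫ x in S, q x ∂ν)]

/-- The integral of a positive function over a set of nonzero measure is positive. -/
theorem setIntegral_pos_of_forall_pos {X : Type*} [MeasurableSpace X] {ν : Measure X}
    {S : Set X} (hS : MeasurableSet S) (hνS : ν S ≠ 0) {p : X → ℝ}
    (hp : IntegrableOn p S ν) (hpos : ∀ x ∈ S, 0 < p x) : 0 < ∫ x in S, p x ∂ν := by
  have hnn : 0 ≤ᵐ[ν.restrict S] p := by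
    filter_upwards [ae_restrict_mem hS] with x hx using (hpos x hx).le
  have hsupp : S ⊆ Function.support p := fun x hx => (hpos x hx).ne'
  rw [setIntegral_pos_iff_support_of_nonneg_ae hnn hp, inter_eq_right.2 hsupp]
  exact pos_iff_ne_zero.2 hνS

/-- If `f / g` is non-decreasing and the kernels satisfy the reversed total positivity condition
`k₁ x * k₂ y ≤ k₂ x * k₁ y` for `x ≤ y`, then passing from `k₁` to `k₂` decreases the ratio of
the weighted integrals of `f` and `g`. -/
theorem setIntegral_mul_div_le_of_kernel {S : Set ℝ} (hS : MeasurableSet S)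
    {f g k₁ k₂ : ℝ → ℝ} (hg_pos : ∀ x ∈ S, 0 < g x)
    (hf_int : IntegrableOn f S) (hg_int : IntegrableOn g S) (hS0 : volume S ≠ 0)
    (hratio : ∀ x ∈ S, ∀ y ∈ S, x ≤ y → f x / g x ≤ f y / g y)
    (hk₁ : ContinuousOn k₁ S) (hk₂ : ContinuousOn k₂ S)
    (hk₁_mem : ∀ x ∈ S, k₁ x ∈ Ioc 0 1) (hk₂_mem : ∀ x ∈ S, k₂ x ∈ Ioc 0 1)
    (hk : ∀ x ∈ S, ∀ y ∈ S, x ≤ y → k₁ x * k₂ y ≤ k₂ x * k₁ y) :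
    (∫ x in S, k₂ x * f x) / (∫ x in S, k₂ x * g x)
      ≤ (∫ x in S, k₁ x * f x) / (∫ x in S, k₁ x * g x) := by
  have hint : ∀ {k h : ℝ → ℝ}, ContinuousOn k S → (∀ x ∈ S, k x ∈ Ioc 0 1) →
      IntegrableOn h S → IntegrableOn (fun x => k x * h x) S := by
    intro k h hkc hkm hh
    refine Integrable.bdd_mul (c := 1) hh (hkc.aestronglyMeasurable hS) ?_
    filter_upwards [ae_restrict_mem hS] with x hx
    rw [Real.norm_of_nonneg (hkm x hx).1.le]
    exact (hkm x hx).2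
  have hpos : ∀ {k : ℝ → ℝ}, ContinuousOn k S → (∀ x ∈ S, k x ∈ Ioc 0 1) →
      0 < ∫ x in S, k x * g x := fun hkc hkm =>
    setIntegral_pos_of_forall_pos hS hS0 (hint hkc hkm hg_int)
      fun x hx => mul_pos (hkm x hx).1 (hg_pos x hx)
  have hcross : ∀ x ∈ S, ∀ y ∈ S, x ≤ y → f x * g y ≤ f y * g x := fun x hx y hy hxy =>
    (div_le_div_iff₀ (hg_pos x hx) (hg_pos y hy)).1 (hratio x hx y hy hxy)
  rw [div_le_div_iff₀ (hpos hk₂ hk₂_mem) (hpos hk₁ hk₁_mem)]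
  refine setIntegral_mul_setIntegral_le_of_symm hS (hint hk₁ hk₁_mem hf_int)
    (hint hk₂ hk₂_mem hg_int) (hint hk₂ hk₂_mem hf_int) (hint hk₁ hk₁_mem hg_int) ?_
  intro x hx y hy
  rcases le_total x y with hxy | hxy
  · nlinarith [mul_nonneg (sub_nonneg.2 (hk x hx y hy hxy)) (sub_nonneg.2 (hcross x hx y hy hxy))]
  · nlinarith [mul_nonneg (sub_nonneg.2 (hk y hy x hx hxy)) (sub_nonneg.2 (hcross y hy x hx hxy))]

/-- Lemma (after Biernacki–Krzyż): if `f, g` are positive continuous probability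
densities on an interval `(α,β) ⊆ (0,∞)` (with `β` possibly `+∞`) whose ratio
`f/g` is non-decreasing, then the ratios of their Laplace transforms and of
their generalized Stieltjes transforms are non-increasing on `(0,∞)`. -/
theorem ratio_transform_monotone (α β : EReal) (hα : (0 : EReal) ≤ α) (hαβ : α < β)
    (f g : ℝ → ℝ) (S : Set ℝ)
    (hS : S = {x : ℝ | α < (x : EReal) ∧ (x : EReal) < β})
    (hf_pos : ∀ x ∈ S, 0 < f x) (hg_pos : ∀ x ∈ S, 0 < g x)
    (hf_cont : ContinuousOn f S) (hg_cont : ContinuousOn g S)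
    (hf_prob : (∫ x in S, f x) = 1) (hg_prob : (∫ x in S, g x) = 1)
    (hratio : ∀ x ∈ S, ∀ y ∈ S, x ≤ y → f x / g x ≤ f y / g y) :
    (∀ z₁ z₂ : ℝ, 0 < z₁ → z₁ ≤ z₂ →
      (∫ x in S, Real.exp (-z₂ * x) * f x) / (∫ x in S, Real.exp (-z₂ * x) * g x)
        ≤ (∫ x in S, Real.exp (-z₁ * x) * f x) / (∫ x in S, Real.exp (-z₁ * x) * g x)) ∧
    (∀ μ : ℝ, 0 < μ → ∀ z₁ z₂ : ℝ, 0 < z₁ → z₁ ≤ z₂ →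
      (∫ x in S, (1 + x * z₂) ^ (-μ) * f x) / (∫ x in S, (1 + x * z₂) ^ (-μ) * g x)
        ≤ (∫ x in S, (1 + x * z₁) ^ (-μ) * f x) / (∫ x in S, (1 + x * z₁) ^ (-μ) * g x)) := by
  have hSm : MeasurableSet S := by
    rw [hS]
    exact (measurableSet_lt measurable_const measurable_coe_real_ereal).inter
      (measurableSet_lt measurable_coe_real_ereal measurable_const)
  have hS_pos : ∀ x ∈ S, 0 < x := by
    intro x hx
    rw [hS] at hx
    exact EReal.coe_pos.1 (hα.trans_lt hx.1)
  have hf_int : IntegrableOn f S := .of_integral_ne_zero (by rw [hf_prob]; exact one_ne_zero)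
  have hg_int : IntegrableOn g S := .of_integral_ne_zero (by rw [hg_prob]; exact one_ne_zero)
  have hS0 : volume S ≠ 0 := by
    intro h
    rw [setIntegral_measure_zero _ h] at hf_prob
    exact zero_ne_one hf_prob
  constructor
  · intro z₁ z₂ hz₁ hz
    have hmem : ∀ z : ℝ, 0 < z → ∀ x ∈ S, Real.exp (-z * x) ∈ Ioc (0 : ℝ) 1 := fun z hz x hx =>
      ⟨Real.exp_pos _, Real.exp_le_one_iff.2 (by nlinarith [mul_pos hz (hS_pos x hx)])⟩
    refine setIntegral_mul_div_le_of_kernel hSm hg_pos hf_int hg_int hS0 hratio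
      (by fun_prop) (by fun_prop) (hmem z₁ hz₁) (hmem z₂ (hz₁.trans_le hz)) ?_
    intro x _ y _ hxy
    rw [← Real.exp_add, ← Real.exp_add, Real.exp_le_exp]
    nlinarith [mul_nonneg (sub_nonneg.2 hz) (sub_nonneg.2 hxy)]
  · intro μ hμ z₁ z₂ hz₁ hz
    have hz₂ : 0 < z₂ := hz₁.trans_le hz
    have hbase : ∀ z : ℝ, 0 < z → ∀ x ∈ S, 1 < 1 + x * z := fun z hz x hx =>
      lt_add_of_pos_right 1 (mul_pos (hS_pos x hx) hz)
    have hbase_pos : ∀ z : ℝ, 0 < z → ∀ x ∈ S, 0 < 1 + x * z := fun z hz x hx =>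
      one_pos.trans (hbase z hz x hx)
    have hmem : ∀ z : ℝ, 0 < z → ∀ x ∈ S, (1 + x * z) ^ (-μ) ∈ Ioc (0 : ℝ) 1 := fun z hz x hx =>
      ⟨Real.rpow_pos_of_pos (hbase_pos z hz x hx) _,
        Real.rpow_le_one_of_one_le_of_nonpos (hbase z hz x hx).le (neg_nonpos.2 hμ.le)⟩
    have hcont : ∀ z : ℝ, 0 < z → ContinuousOn (fun x : ℝ => (1 + x * z) ^ (-μ)) S := fun z hz =>
      ContinuousOn.rpow_const (by fun_prop) fun x hx => Or.inl (hbase_pos z hz x hx).ne'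
    refine setIntegral_mul_div_le_of_kernel hSm hg_pos hf_int hg_int hS0 hratio
      (hcont z₁ hz₁) (hcont z₂ hz₂) (hmem z₁ hz₁) (hmem z₂ hz₂) ?_
    intro x hx y hy hxy
    have hx₁ := hbase_pos z₁ hz₁ x hx
    have hx₂ := hbase_pos z₂ hz₂ x hx
    have hy₁ := hbase_pos z₁ hz₁ y hy
    have hy₂ := hbase_pos z₂ hz₂ y hy
    rw [← Real.mul_rpow hx₁.le hy₂.le, ← Real.mul_rpow hx₂.le hy₁.le]
    exact Real.rpow_le_rpow_of_nonpos (mul_pos hx₂ hy₁)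
      (by nlinarith [mul_nonneg (sub_nonneg.2 hz) (sub_nonneg.2 hxy)]) (neg_nonpos.2 hμ.le)
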